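/- In the fast diffusion setting below, for every real q ≥ 2 the function M_q(t) = ∫_Ω |𝓡(x,t) − 1|^q u(x,t)^{p+1} dx is differentiable on (0,T) and satisfies the evolution identity (d/dt) M_q(t) = −(q(q−1)/p) ∫_Ω |𝓡 − 1|^{q−2} |∇(𝓡 − 1)|² u² dx + ∫_Ω [ ((p−1)/p)(q − (p+1)/(p−1)) |𝓡 − 1|^q (𝓡 − 1) + (q − q/p) |𝓡 − 1|^q ] u^{p+1} dx, where 𝓡(x,t) = u(x,t)^{−p} ( −Δu(x,t) − b u(x,t) ). -/

import Mathlib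

open MeasureTheory Real Set

noncomputable section

/-- Partial derivative in the `i`-th coordinate direction. -/
def pderiv' {n : ℕ} (i : Fin n) (f : EuclideanSpace ℝ (Fin n) → ℝ)
    (x : EuclideanSpace ℝ (Fin n)) : ℝ :=
  fderiv ℝ f x (EuclideanSpace.single i 1)

/-- The Laplacian `Δf = ∑ᵢ ∂ᵢ∂ᵢ f`. -/
def lap {n : ℕ} (f : EuclideanSpace ℝ (Fin n) → ℝ) (x : EuclideanSpace ℝ (Fin n)) : ℝ :=
  ∑ i, pderiv' i (pderiv' i f) x

/-- Distance to the boundary of `Ω`. -/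
def dB {n : ℕ} (Ω : Set (EuclideanSpace ℝ (Fin n))) (x : EuclideanSpace ℝ (Fin n)) : ℝ :=
  Metric.infDist x (frontier Ω)

/-- A smooth bounded domain: a nonempty bounded open set which is the sublevel set
of a smooth defining function with nonvanishing gradient on the boundary. -/
def IsSmoothDomain {n : ℕ} (Ω : Set (EuclideanSpace ℝ (Fin n))) : Prop :=
  IsOpen Ω ∧ Bornology.IsBounded Ω ∧ Ω.Nonempty ∧
    ∃ Φ : EuclideanSpace ℝ (Fin n) → ℝ, ContDiff ℝ (⊤ : ℕ∞) Φ ∧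
      Ω = {x | Φ x < 0} ∧ frontier Ω = {x | Φ x = 0} ∧
      ∀ x ∈ frontier Ω, gradient Φ x ≠ 0

/-- A function on `Ω × [0,T]` extends continuously to `closure Ω × [0,T]`. -/
def ExtendsCont {n : ℕ} (Ω : Set (EuclideanSpace ℝ (Fin n))) (T : ℝ)
    (f : EuclideanSpace ℝ (Fin n) → ℝ → ℝ) : Prop :=
  ∃ g : EuclideanSpace ℝ (Fin n) → ℝ → ℝ,
    ContinuousOn (fun z : EuclideanSpace ℝ (Fin n) × ℝ => g z.1 z.2)
      (closure Ω ×ˢ Set.Icc 0 T) ∧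
    ∀ x ∈ Ω, ∀ t ∈ Set.Icc 0 T, g x t = f x t

/-- Membership in `C^{3,2}(closure Ω × [0,T])`, with the first and second time
derivatives recorded as the functions `ut` and `utt`:  `u`, `D_x u`, `D_x² u`,
`D_x³ u`, `∂ₜ u`, `D_x ∂ₜ u`, `D_x² ∂ₜ u`, `∂ₜ² u` all extend continuously to
`closure Ω × [0,T]`. -/
def C32 {n : ℕ} (Ω : Set (EuclideanSpace ℝ (Fin n))) (T : ℝ)
    (u ut utt : EuclideanSpace ℝ (Fin n) → ℝ → ℝ) : Prop :=
  (∀ t ∈ Set.Icc (0 : ℝ) T, ContDiffOn ℝ 3 (fun x => u x t) Ω) ∧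
  (∀ t ∈ Set.Icc (0 : ℝ) T, ContDiffOn ℝ 2 (fun x => ut x t) Ω) ∧
  (∀ x ∈ Ω, ∀ t ∈ Set.Icc (0 : ℝ) T, HasDerivWithinAt (u x) (ut x t) (Set.Icc 0 T) t) ∧
  (∀ x ∈ Ω, ∀ t ∈ Set.Icc (0 : ℝ) T, HasDerivWithinAt (ut x) (utt x t) (Set.Icc 0 T) t) ∧
  ContinuousOn (fun z : EuclideanSpace ℝ (Fin n) × ℝ => u z.1 z.2)
    (closure Ω ×ˢ Set.Icc 0 T) ∧
  ContinuousOn (fun z : EuclideanSpace ℝ (Fin n) × ℝ => ut z.1 z.2)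
    (closure Ω ×ˢ Set.Icc 0 T) ∧
  ContinuousOn (fun z : EuclideanSpace ℝ (Fin n) × ℝ => utt z.1 z.2)
    (closure Ω ×ˢ Set.Icc 0 T) ∧
  (∀ i : Fin n, ExtendsCont Ω T fun x t => pderiv' i (fun y => u y t) x) ∧
  (∀ i j : Fin n, ExtendsCont Ω T fun x t => pderiv' i (pderiv' j fun y => u y t) x) ∧
  (∀ i j k : Fin n,
    ExtendsCont Ω T fun x t => pderiv' i (pderiv' j (pderiv' k fun y => u y t)) x) ∧
  (∀ i : Fin n, ExtendsCont Ω T fun x t => pderiv' i (fun y => ut y t) x) ∧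
  (∀ i j : Fin n, ExtendsCont Ω T fun x t => pderiv' i (pderiv' j fun y => ut y t) x)

/-- The fast diffusion setting of Section 4 of the paper: `u ∈ C^{3,2}(closure Ω × [0,T])`
is positive in `Ω × [0,T]`, solves `∂ₜ(u^p) = Δu + bu + u^p` in `Ω × (0,T]`, vanishes
on `∂Ω × [0,T]`, and is comparable to the distance to the boundary. -/
def FDSetting {n : ℕ} (Ω : Set (EuclideanSpace ℝ (Fin n))) (p b T c₀ : ℝ)
    (u ut utt : EuclideanSpace ℝ (Fin n) → ℝ → ℝ) : Prop :=
  IsSmoothDomain Ω ∧ 1 < p ∧ (n ≤ 2 ∨ p ≤ ((n : ℝ) + 2) / ((n : ℝ) - 2)) ∧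
  0 < T ∧ 1 ≤ c₀ ∧
  C32 Ω T u ut utt ∧
  (∀ x ∈ Ω, ∀ t ∈ Set.Icc (0 : ℝ) T, 0 < u x t) ∧
  (∀ x ∈ Ω, ∀ t ∈ Set.Ioc (0 : ℝ) T,
      HasDerivWithinAt (fun s => u x s ^ p)
        (lap (fun y => u y t) x + b * u x t + u x t ^ p) (Set.Icc 0 T) t) ∧
  (∀ x ∈ frontier Ω, ∀ t ∈ Set.Icc (0 : ℝ) T, u x t = 0) ∧
  (∀ x ∈ Ω, ∀ t ∈ Set.Icc (0 : ℝ) T,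
      c₀⁻¹ * dB Ω x ≤ u x t ∧ u x t ≤ c₀ * dB Ω x)

/-- The curvature-like quantity `𝓡 = u^{-p} (-Δu - bu)`. -/
def curvQ {n : ℕ} (p b : ℝ) (u : EuclideanSpace ℝ (Fin n) → ℝ → ℝ)
    (x : EuclideanSpace ℝ (Fin n)) (t : ℝ) : ℝ :=
  u x t ^ (-p) * (-(lap (fun y => u y t) x) - b * u x t)

open Filter Topology

theorem hasDerivAt_abs_rpow_mul_self {q : ℝ} (hq : 2 ≤ q) (s : ℝ) :
    HasDerivAt (fun s : ℝ => |s| ^ (q - 2) * s) ((q - 1) * |s| ^ (q - 2)) s := by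
  rcases eq_or_ne s 0 with rfl | hs
  · have hc : Continuous fun s : ℝ => |s| ^ (q - 2) :=
      continuous_abs.rpow_const fun _ => Or.inr (by linarith)
    have h0 : (q - 1) * |(0 : ℝ)| ^ (q - 2) = |(0 : ℝ)| ^ (q - 2) := by
      rcases hq.eq_or_lt with rfl | hq
      · norm_num
      · rw [abs_zero, Real.zero_rpow (by linarith), mul_zero]
    rw [h0, hasDerivAt_iff_tendsto_slope]
    refine (hc.continuousAt.tendsto.mono_left nhdsWithin_le_nhds).congr' ?_
    filter_upwards [self_mem_nhdsWithin] with y hy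
    have hy : y ≠ 0 := hy
    simp [slope_def_field, hy]
  · have h1 := ((hasDerivAt_abs hs).rpow_const (p := q - 2) (Or.inl (abs_ne_zero.2 hs))).mul
      (hasDerivAt_id s)
    refine h1.congr_deriv ?_
    have h2 : |s| ^ (q - 2) = |s| ^ (q - 2 - 1) * |s| := by
      rw [← Real.rpow_add_one (abs_ne_zero.2 hs)]; ring_nf
    have h3 : (SignType.sign s : ℝ) * s = |s| := sign_mul_self s
    simp only [id]
    calc _ = (q - 2) * |s| ^ (q - 2 - 1) * ((SignType.sign s : ℝ) * s) + |s| ^ (q - 2) := by ring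
      _ = _ := by rw [h3, h2]; ring

theorem integrableOn_of_continuousOn_of_abs_le {n : ℕ} {Ω : Set (EuclideanSpace ℝ (Fin n))}
    (hΩ : IsOpen Ω) (hb : Bornology.IsBounded Ω) {f : EuclideanSpace ℝ (Fin n) → ℝ}
    (hf : ContinuousOn f Ω) {C : ℝ} (hC : ∀ x ∈ Ω, |f x| ≤ C) : IntegrableOn f Ω :=
  IntegrableOn.of_bound hb.measure_lt_top (hf.aestronglyMeasurable hΩ.measurableSet) C
    (ae_restrict_of_forall_mem hΩ.measurableSet hC)

theorem exists_bound_deriv_smoothTransition_mul :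
    ∃ K : ℝ, ∀ r : ℝ, |deriv smoothTransition (r - 1) * r| ≤ K := by
  have hc : Continuous fun r : ℝ => deriv smoothTransition (r - 1) * r :=
    (((smoothTransition.contDiff (n := 1)).continuous_deriv le_rfl).comp
      (continuous_id.sub continuous_const)).mul continuous_id
  obtain ⟨K, hK⟩ := (isCompact_Icc (a := (0 : ℝ)) (b := 3)).exists_bound_of_continuousOn
    hc.continuousOn
  refine ⟨K, fun r => ?_⟩
  by_cases hr : r ∈ Icc (0 : ℝ) 3
  · exact hK r hr
  have h0 : deriv smoothTransition (r - 1) = 0 := by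
    rw [mem_Icc, not_and_or, not_le, not_le] at hr
    rcases hr with hr | hr
    · have : smoothTransition =ᶠ[𝓝 (r - 1)] fun _ => 0 := by
        filter_upwards [Iio_mem_nhds (show r - 1 < 0 by linarith)] with y hy
        exact smoothTransition.zero_of_nonpos (le_of_lt hy)
      rw [this.deriv_eq]; simp
    · have : smoothTransition =ᶠ[𝓝 (r - 1)] fun _ => 1 := by
        filter_upwards [Ioi_mem_nhds (show 1 < r - 1 by linarith)] with y hy
        exact smoothTransition.one_of_one_le (le_of_lt hy)
      rw [this.deriv_eq]; simp
  rw [h0, zero_mul, abs_zero]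
  exact (norm_nonneg _).trans (hK 0 (by norm_num))

theorem integral_eq_zero_of_hasLineDerivAt {n : ℕ} {g g' : EuclideanSpace ℝ (Fin n) → ℝ}
    {e : EuclideanSpace ℝ (Fin n)} (hg : Integrable g) (hg' : Integrable g')
    (hd : ∀ x, HasLineDerivAt ℝ g (g' x) x e) : ∫ x, g' x = 0 := by
  have := integral_bilinear_hasLineDerivAt_right_eq_neg_left_of_integrable (μ := volume)
    (f := fun _ : EuclideanSpace ℝ (Fin n) => (1 : ℝ)) (f' := fun _ => 0) (g := g) (g' := g')
    (v := e) (B := ContinuousLinearMap.mul ℝ ℝ) (by simp) (by simpa using hg')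
    (by simpa using hg) (fun x _ => by simpa using (hasFDerivAt_const (1 : ℝ) x).hasLineDerivAt e) (fun x _ => hd x)
  simpa using this

theorem hasLineDerivAt_pderiv' {n : ℕ} {f : EuclideanSpace ℝ (Fin n) → ℝ}
    {x : EuclideanSpace ℝ (Fin n)} (hf : DifferentiableAt ℝ f x) (i : Fin n) :
    HasLineDerivAt ℝ f (pderiv' i f x) x (EuclideanSpace.single i 1) :=
  hf.hasFDerivAt.hasLineDerivAt _

theorem HasLineDerivAt.comp_hasDerivAt {n : ℕ} {f : EuclideanSpace ℝ (Fin n) → ℝ} {f' : ℝ}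
    {x e : EuclideanSpace ℝ (Fin n)} (hf : HasLineDerivAt ℝ f f' x e) {φ : ℝ → ℝ} {φ' : ℝ}
    (hφ : HasDerivAt φ φ' (f x)) : HasLineDerivAt ℝ (fun y => φ (f y)) (φ' * f') x e := by
  have h0 : HasDerivAt φ φ' (f (x + (0 : ℝ) • e)) := by simpa using hφ
  exact HasDerivAt.comp (0 : ℝ) h0 hf

theorem HasLineDerivAt.mul_real {n : ℕ} {f g : EuclideanSpace ℝ (Fin n) → ℝ} {f' g' : ℝ}
    {x e : EuclideanSpace ℝ (Fin n)} (hf : HasLineDerivAt ℝ f f' x e)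
    (hg : HasLineDerivAt ℝ g g' x e) :
    HasLineDerivAt ℝ (fun y => f y * g y) (f' * g x + f x * g') x e := by
  have := HasDerivAt.fun_mul (𝕜 := ℝ) hf hg
  simp only [zero_smul, add_zero] at this
  exact this

theorem HasLineDerivAt.sub_real {n : ℕ} {f g : EuclideanSpace ℝ (Fin n) → ℝ} {f' g' : ℝ}
    {x e : EuclideanSpace ℝ (Fin n)} (hf : HasLineDerivAt ℝ f f' x e)
    (hg : HasLineDerivAt ℝ g g' x e) :
    HasLineDerivAt ℝ (fun y => f y - g y) (f' - g') x e :=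
  HasDerivAt.sub (𝕜 := ℝ) hf hg

theorem HasLineDerivAt.div_real {n : ℕ} {f g : EuclideanSpace ℝ (Fin n) → ℝ} {f' g' : ℝ}
    {x e : EuclideanSpace ℝ (Fin n)} (hf : HasLineDerivAt ℝ f f' x e)
    (hg : HasLineDerivAt ℝ g g' x e) (h0 : g x ≠ 0) :
    HasLineDerivAt ℝ (fun y => f y / g y) ((f' * g x - f x * g') / g x ^ 2) x e := by
  have := HasDerivAt.fun_div (𝕜 := ℝ) hf hg (by simpa using h0)
  simp only [zero_smul, add_zero] at this
  exact this

/-- If a scalar flux is controlled by a function `u` vanishing at the boundary, then the integral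
of its derivative vanishes: no regularity of the boundary is needed. -/
theorem setIntegral_pderiv'_eq_zero {n : ℕ} {Ω : Set (EuclideanSpace ℝ (Fin n))}
    (hΩ : IsOpen Ω) (hb : Bornology.IsBounded Ω) {u f : EuclideanSpace ℝ (Fin n) → ℝ} {i : Fin n}
    (hu : DifferentiableOn ℝ u Ω) (hf : DifferentiableOn ℝ f Ω)
    (hu' : ContinuousOn (pderiv' i u) Ω) (hf' : ContinuousOn (pderiv' i f) Ω)
    (hpos : ∀ x ∈ Ω, 0 < u x) {C : ℝ} (hC : 0 ≤ C)
    (hud : ∀ x ∈ Ω, u x ≤ C * Metric.infDist x Ωᶜ)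
    (hfu : ∀ x ∈ Ω, |f x| ≤ C * u x)
    (hub : ∀ x ∈ Ω, u x ≤ C)
    (hbu' : ∀ x ∈ Ω, |pderiv' i u x| ≤ C) (hbf' : ∀ x ∈ Ω, |pderiv' i f x| ≤ C) :
    ∫ x in Ω, pderiv' i f x = 0 := by
  obtain ⟨K, hK⟩ := exists_bound_deriv_smoothTransition_mul
  have hψc : Continuous (deriv smoothTransition) :=
    (smoothTransition.contDiff (n := 1)).continuous_deriv le_rfl
  have hψd : ∀ s, HasDerivAt smoothTransition (deriv smoothTransition s) s := fun s =>
    ((smoothTransition.contDiff (n := 1)).differentiable one_ne_zero s).hasDerivAt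
  let G : ℝ → EuclideanSpace ℝ (Fin n) → ℝ := fun ε x => smoothTransition (u x / ε - 1) * f x
  let G' : ℝ → EuclideanSpace ℝ (Fin n) → ℝ := fun ε x =>
    deriv smoothTransition (u x / ε - 1) * (pderiv' i u x / ε) * f x +
      smoothTransition (u x / ε - 1) * pderiv' i f x
  have hψabs : ∀ s, |smoothTransition s| ≤ 1 := fun s => by
    rw [abs_of_nonneg (smoothTransition.nonneg s)]; exact smoothTransition.le_one s
  have hGb : ∀ ε, ∀ x ∈ Ω, |G ε x| ≤ C * C := fun ε x hx => by
    rw [abs_mul]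
    calc _ ≤ 1 * (C * u x) := mul_le_mul (hψabs _) (hfu x hx) (abs_nonneg _) zero_le_one
      _ ≤ C * C := by rw [one_mul]; exact mul_le_mul_of_nonneg_left (hub x hx) hC
  have hG'b : ∀ ε, 0 < ε → ∀ x ∈ Ω, |G' ε x| ≤ K * C * C + C := fun ε hε x hx => by
    refine (abs_add_le _ _).trans (add_le_add ?_ ?_)
    · have h1 := hK (u x / ε)
      have h2 : |f x| / u x ≤ C := by rw [div_le_iff₀ (hpos x hx)]; exact hfu x hx
      have h3 : |deriv smoothTransition (u x / ε - 1) * (pderiv' i u x / ε) * f x| =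
          |deriv smoothTransition (u x / ε - 1) * (u x / ε)| * |pderiv' i u x| *
            (|f x| / u x) := by
        simp only [abs_mul, abs_div, abs_of_pos hε, abs_of_pos (hpos x hx)]
        field_simp [(hpos x hx).ne']
      rw [h3]
      have hK0 : 0 ≤ K := (abs_nonneg _).trans h1
      have h4 : 0 ≤ |f x| / u x := div_nonneg (abs_nonneg _) (hpos x hx).le
      exact mul_le_mul (mul_le_mul h1 (hbu' x hx) (abs_nonneg _) hK0) h2 h4 (mul_nonneg hK0 hC)
    · rw [abs_mul]
      calc _ ≤ 1 * C := mul_le_mul (hψabs _) (hbf' x hx) (abs_nonneg _) zero_le_one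
        _ = C := one_mul C
  have hargc : ∀ ε, ContinuousOn (fun x => u x / ε - 1) Ω := fun ε =>
    (hu.continuousOn.div_const ε).sub continuousOn_const
  have hGc : ∀ ε, ContinuousOn (G ε) Ω := fun ε =>
    (smoothTransition.continuous.comp_continuousOn (hargc ε)).mul hf.continuousOn
  have hG'c : ∀ ε, ContinuousOn (G' ε) Ω := fun ε =>
    (((hψc.comp_continuousOn (hargc ε)).mul (hu'.div_const ε)).mul hf.continuousOn).add
      ((smoothTransition.continuous.comp_continuousOn (hargc ε)).mul hf')
  have hzero : ∀ ε, 0 < ε → ∫ x in Ω, G' ε x = 0 := by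
    intro ε hε
    rw [← integral_indicator hΩ.measurableSet]
    refine integral_eq_zero_of_hasLineDerivAt (g := Ω.indicator (G ε))
      (e := EuclideanSpace.single i 1)
      ((integrable_indicator_iff hΩ.measurableSet).2
        (integrableOn_of_continuousOn_of_abs_le hΩ hb (hGc ε) (hGb ε)))
      ((integrable_indicator_iff hΩ.measurableSet).2
        (integrableOn_of_continuousOn_of_abs_le hΩ hb (hG'c ε) (hG'b ε hε))) ?_
    intro x
    by_cases hx : x ∈ Ω
    · have h1 : HasLineDerivAt ℝ (G ε) (G' ε x) x (EuclideanSpace.single i 1) := by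
        have hux := hasLineDerivAt_pderiv' (hu.differentiableAt (hΩ.mem_nhds hx)) i
        have hfx := hasLineDerivAt_pderiv' (hf.differentiableAt (hΩ.mem_nhds hx)) i
        have h2 := hux.comp_hasDerivAt (φ := fun s => smoothTransition (s / ε - 1))
          (φ' := deriv smoothTransition (u x / ε - 1) * (1 / ε))
          ((hψd _).comp (u x) (((hasDerivAt_id (u x)).div_const ε).sub_const 1))
        have h3 := h2.mul_real hfx
        convert h3 using 1
        simp only [G']; ring
      rw [indicator_of_mem hx]
      exact h1.congr_of_eventuallyEq
        ((hΩ.eventually_mem hx).mono fun y hy => indicator_of_mem hy _)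
    · rw [indicator_of_notMem hx]
      have h0 : Ω.indicator (G ε) =ᶠ[𝓝 x] fun _ => 0 := by
        have hc : Continuous fun y => C * Metric.infDist y Ωᶜ :=
          continuous_const.mul (Metric.continuous_infDist_pt _)
        have : ∀ᶠ y in 𝓝 x, C * Metric.infDist y Ωᶜ < ε := by
          refine hc.continuousAt.eventually_lt continuousAt_const ?_
          rw [Metric.infDist_zero_of_mem hx, mul_zero]; exact hε
        filter_upwards [this] with y hy
        by_cases hyΩ : y ∈ Ω
        · rw [indicator_of_mem hyΩ]
          have : u y / ε - 1 ≤ 0 := by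
            rw [sub_nonpos, div_le_one hε]; exact (hud y hyΩ).trans hy.le
          simp only [G, smoothTransition.zero_of_nonpos this, zero_mul]
        · exact indicator_of_notMem hyΩ _
      have h1 : HasLineDerivAt ℝ (fun _ => (0 : ℝ)) 0 x (EuclideanSpace.single i (1 : ℝ)) := by
        simpa using (hasFDerivAt_const (0 : ℝ) x).hasLineDerivAt (EuclideanSpace.single i 1)
      exact h1.congr_of_eventuallyEq h0
  have hlim : Tendsto (fun k : ℕ => ∫ x in Ω, G' (1 / ((k : ℝ) + 1)) x) atTop
      (𝓝 (∫ x in Ω, pderiv' i f x)) := by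
    refine tendsto_integral_of_dominated_convergence (fun _ => K * C * C + C)
      (fun k => (hG'c _).aestronglyMeasurable hΩ.measurableSet)
      (integrableOn_const (by exact hb.measure_lt_top.ne))
      (fun k => ae_restrict_of_forall_mem hΩ.measurableSet (hG'b _ (by positivity)))
      (ae_restrict_of_forall_mem hΩ.measurableSet fun x hx => ?_)
    refine tendsto_const_nhds.congr' ?_
    have h1 : ∀ᶠ k : ℕ in atTop, 1 / ((k : ℝ) + 1) < u x / 2 :=
      tendsto_one_div_add_atTop_nhds_zero_nat.eventually_lt_const (half_pos (hpos x hx))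
    filter_upwards [h1] with k hk
    have hε : (0 : ℝ) < 1 / ((k : ℝ) + 1) := by positivity
    have h2 : 1 < u x / (1 / ((k : ℝ) + 1)) - 1 := by
      rw [lt_sub_iff_add_lt, lt_div_iff₀ hε]; linarith
    have h3 : deriv smoothTransition (u x / (1 / ((k : ℝ) + 1)) - 1) = 0 := by
      have : smoothTransition =ᶠ[𝓝 (u x / (1 / ((k : ℝ) + 1)) - 1)] fun _ => 1 := by
        filter_upwards [Ioi_mem_nhds h2] with y hy
        exact smoothTransition.one_of_one_le (le_of_lt hy)
      rw [this.deriv_eq]; simp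
    simp only [G', h3, smoothTransition.one_of_one_le h2.le]; ring
  refine tendsto_nhds_unique hlim ?_
  refine tendsto_const_nhds.congr fun k => (hzero _ (by positivity)).symm

theorem norm_gradient_sq_eq_sum {n : ℕ} (f : EuclideanSpace ℝ (Fin n) → ℝ)
    (x : EuclideanSpace ℝ (Fin n)) : ‖gradient f x‖ ^ 2 = ∑ i, pderiv' i f x ^ 2 := by
  rw [EuclideanSpace.real_norm_sq_eq]
  refine Finset.sum_congr rfl fun i _ => ?_
  have : inner ℝ (gradient f x) (EuclideanSpace.single i 1) = pderiv' i f x :=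
    InnerProductSpace.toDual_symm_apply
  rw [← this, EuclideanSpace.inner_single_right]
  simp

theorem contDiffOn_pderiv' {n : ℕ} {Ω : Set (EuclideanSpace ℝ (Fin n))} (hΩ : IsOpen Ω)
    {f : EuclideanSpace ℝ (Fin n) → ℝ} {k m : WithTop ℕ∞} (hf : ContDiffOn ℝ k f Ω)
    (hm : m + 1 ≤ k) (i : Fin n) : ContDiffOn ℝ m (pderiv' i f) Ω :=
  (hf.fderiv_of_isOpen hΩ hm).clm_apply contDiffOn_const

theorem HasLineDerivAt.pderiv'_eq {n : ℕ} {f : EuclideanSpace ℝ (Fin n) → ℝ} {f' : ℝ}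
    {x : EuclideanSpace ℝ (Fin n)} {i : Fin n} (hd : DifferentiableAt ℝ f x)
    (hf : HasLineDerivAt ℝ f f' x (EuclideanSpace.single i 1)) : pderiv' i f x = f' :=
  (hasLineDerivAt_pderiv' hd i).unique hf

/-- One coordinate of the integration by parts identity for `w = c v / u`, tested against
`|w|^(q-2) w`. -/
theorem setIntegral_coord_flux {n : ℕ} {Ω : Set (EuclideanSpace ℝ (Fin n))}
    (hΩ : IsOpen Ω) (hb : Bornology.IsBounded Ω) {u v : EuclideanSpace ℝ (Fin n) → ℝ}
    (hu : ContDiffOn ℝ 2 u Ω) (hv : ContDiffOn ℝ 2 v Ω) {q : ℝ} (hq : 2 ≤ q) (c : ℝ)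
    (hpos : ∀ x ∈ Ω, 0 < u x) {C : ℝ} (hC : 0 ≤ C)
    (hud : ∀ x ∈ Ω, u x ≤ C * Metric.infDist x Ωᶜ)
    (hvu : ∀ x ∈ Ω, |v x| ≤ C * u x) (hub : ∀ x ∈ Ω, u x ≤ C) (i : Fin n)
    (hu1 : ∀ x ∈ Ω, |pderiv' i u x| ≤ C) (hv1 : ∀ x ∈ Ω, |pderiv' i v x| ≤ C)
    (hu2 : ∀ x ∈ Ω, |pderiv' i (pderiv' i u) x| ≤ C)
    (hv2 : ∀ x ∈ Ω, |pderiv' i (pderiv' i v) x| ≤ C) :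
    IntegrableOn (fun x => |c * (v x / u x)| ^ (q - 2) *
      pderiv' i (fun y => c * (v y / u y)) x ^ 2 * u x ^ 2) Ω ∧
    IntegrableOn (fun x => |c * (v x / u x)| ^ (q - 2) * (c * (v x / u x)) *
      (c * (u x * pderiv' i (pderiv' i v) x - v x * pderiv' i (pderiv' i u) x))) Ω ∧
    (q - 1) * ∫ x in Ω, |c * (v x / u x)| ^ (q - 2) *
      pderiv' i (fun y => c * (v y / u y)) x ^ 2 * u x ^ 2 =
    -∫ x in Ω, |c * (v x / u x)| ^ (q - 2) * (c * (v x / u x)) *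
      (c * (u x * pderiv' i (pderiv' i v) x - v x * pderiv' i (pderiv' i u) x)) := by
  have hu1d := contDiffOn_pderiv' hΩ hu (m := 1) (by norm_num) i
  have hv1d := contDiffOn_pderiv' hΩ hv (m := 1) (by norm_num) i
  have hu2c := (contDiffOn_pderiv' hΩ hu1d (m := 0) (by norm_num) i).continuousOn
  have hv2c := (contDiffOn_pderiv' hΩ hv1d (m := 0) (by norm_num) i).continuousOn
  have hud1 := hu.differentiableOn (by norm_num)
  have hvd1 := hv.differentiableOn (by norm_num)
  set w : EuclideanSpace ℝ (Fin n) → ℝ := fun y => c * (v y / u y) with hw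
  have hwd : ContDiffOn ℝ 2 w Ω :=
    contDiffOn_const.mul (hv.div hu fun x hx => (hpos x hx).ne')
  have hw1c := (contDiffOn_pderiv' hΩ hwd (m := 1) (by norm_num) i).continuousOn
  have hw1 : ∀ x ∈ Ω, pderiv' i w x =
      c * ((pderiv' i v x * u x - v x * pderiv' i u x) / u x ^ 2) := by
    intro x hx
    have hn := hΩ.mem_nhds hx
    refine HasLineDerivAt.pderiv'_eq ((hwd.differentiableOn (by norm_num)).differentiableAt hn) ?_
    have h1 := (hasLineDerivAt_pderiv' (hvd1.differentiableAt hn) i).div_real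
      (hasLineDerivAt_pderiv' (hud1.differentiableAt hn) i) (hpos x hx).ne'
    simpa using h1.comp_hasDerivAt (φ := fun s => c * s) (φ' := c)
      (by simpa using (hasDerivAt_id _).const_mul c)
  have hq0 : 0 ≤ q - 2 := by linarith
  set P := (|c| * C) ^ (q - 2) with hP
  have hP0 : 0 ≤ P := by positivity
  have hwb : ∀ x ∈ Ω, |w x| ≤ |c| * C := by
    intro x hx
    rw [hw, abs_mul, abs_div, abs_of_pos (hpos x hx)]
    refine mul_le_mul_of_nonneg_left ?_ (abs_nonneg c)
    rw [div_le_iff₀ (hpos x hx)]; exact hvu x hx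
  have hwp : ∀ x ∈ Ω, |w x| ^ (q - 2) ≤ P := fun x hx =>
    Real.rpow_le_rpow (abs_nonneg _) (hwb x hx) hq0
  have hwpc : ContinuousOn (fun x => |w x| ^ (q - 2)) Ω :=
    hwd.continuousOn.abs.rpow_const fun _ _ => Or.inr hq0
  set J : EuclideanSpace ℝ (Fin n) → ℝ := fun x => c * (u x * pderiv' i v x - v x * pderiv' i u x)
    with hJ
  set L : EuclideanSpace ℝ (Fin n) → ℝ := fun x =>
    c * (u x * pderiv' i (pderiv' i v) x - v x * pderiv' i (pderiv' i u) x) with hL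
  have hcomb : ∀ x ∈ Ω, ∀ a b : ℝ, |a| ≤ C → |b| ≤ C →
      |c * (u x * a - v x * b)| ≤ |c| * (C + C * C) * u x := by
    intro x hx a b ha hb'
    rw [abs_mul, mul_assoc]
    refine mul_le_mul_of_nonneg_left ?_ (abs_nonneg c)
    have h1 : |u x * a| ≤ u x * C := by
      rw [abs_mul, abs_of_pos (hpos x hx)]
      exact mul_le_mul_of_nonneg_left ha (hpos x hx).le
    have h2 : |v x * b| ≤ C * u x * C := by
      rw [abs_mul]
      exact mul_le_mul (hvu x hx) hb' (abs_nonneg _) (mul_nonneg hC (hpos x hx).le)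
    calc _ ≤ |u x * a| + |v x * b| := abs_sub _ _
      _ ≤ u x * C + C * u x * C := add_le_add h1 h2
      _ = _ := by ring
  set Q := |c| * (C + C * C) with hQ
  have hQ0 : 0 ≤ Q := by positivity
  have hJb : ∀ x ∈ Ω, |J x| ≤ Q * u x := fun x hx => hcomb x hx _ _ (hv1 x hx) (hu1 x hx)
  have hLb : ∀ x ∈ Ω, |L x| ≤ Q * u x := fun x hx => hcomb x hx _ _ (hv2 x hx) (hu2 x hx)
  have hJc : DifferentiableOn ℝ J Ω := ((hud1.mul (hv1d.differentiableOn one_ne_zero)).sub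
    (hvd1.mul (hu1d.differentiableOn one_ne_zero))).const_mul c
  have hLc : ContinuousOn L Ω := continuousOn_const.mul
    ((hu.continuousOn.mul hv2c).sub (hv.continuousOn.mul hu2c))
  have hwJ : ∀ x ∈ Ω, pderiv' i w x * u x ^ 2 = J x := fun x hx => by
    rw [hw1 x hx]; field_simp [(hpos x hx).ne']; simp only [hJ]; ring
  have hwu : ∀ x ∈ Ω, |pderiv' i w x * u x| ≤ Q := fun x hx => by
    refine le_of_mul_le_mul_right ?_ (hpos x hx)
    calc |pderiv' i w x * u x| * u x = |J x| := by
          rw [← hwJ x hx, abs_mul, abs_mul, abs_pow, abs_of_pos (hpos x hx)]; ring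
      _ ≤ _ := hJb x hx
  have hAb : ∀ x ∈ Ω, |(|w x| ^ (q - 2) * pderiv' i w x ^ 2 * u x ^ 2)| ≤ P * Q ^ 2 := by
    intro x hx
    rw [mul_assoc, ← mul_pow, abs_mul, abs_pow, abs_of_nonneg (by positivity)]
    exact mul_le_mul (hwp x hx) (pow_le_pow_left₀ (abs_nonneg _) (hwu x hx) 2) (by positivity) hP0
  have hφb : ∀ x ∈ Ω, |(|w x| ^ (q - 2) * w x)| ≤ P * (|c| * C) := by
    intro x hx
    rw [abs_mul, abs_of_nonneg (by positivity)]
    exact mul_le_mul (hwp x hx) (hwb x hx) (abs_nonneg _) hP0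
  have hBb : ∀ x ∈ Ω, |(|w x| ^ (q - 2) * w x * L x)| ≤ P * (|c| * C) * (Q * C) := by
    intro x hx
    rw [abs_mul]
    exact mul_le_mul (hφb x hx) ((hLb x hx).trans (mul_le_mul_of_nonneg_left (hub x hx) hQ0))
      (abs_nonneg _) (by positivity)
  have hAc : ContinuousOn (fun x => |w x| ^ (q - 2) * pderiv' i w x ^ 2 * u x ^ 2) Ω :=
    (hwpc.mul (hw1c.pow 2)).mul (hu.continuousOn.pow 2)
  have hBc : ContinuousOn (fun x => |w x| ^ (q - 2) * w x * L x) Ω :=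
    (hwpc.mul hwd.continuousOn).mul hLc
  have hAi := integrableOn_of_continuousOn_of_abs_le hΩ hb hAc hAb
  have hBi := integrableOn_of_continuousOn_of_abs_le hΩ hb hBc hBb
  refine ⟨hAi, hBi, ?_⟩
  have hfd : ∀ x ∈ Ω, DifferentiableAt ℝ (fun x => |w x| ^ (q - 2) * w x * J x) x := by
    intro x hx
    have hn := hΩ.mem_nhds hx
    exact ((hasDerivAt_abs_rpow_mul_self hq (w x)).differentiableAt.comp x
      ((hwd.differentiableOn (by norm_num)).differentiableAt hn)).mul (hJc.differentiableAt hn)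
  have hf' : ∀ x ∈ Ω, pderiv' i (fun x => |w x| ^ (q - 2) * w x * J x) x =
      (q - 1) * (|w x| ^ (q - 2) * pderiv' i w x ^ 2 * u x ^ 2) +
        |w x| ^ (q - 2) * w x * L x := by
    intro x hx
    have hn := hΩ.mem_nhds hx
    refine HasLineDerivAt.pderiv'_eq (hfd x hx) ?_
    have h1 := (hasLineDerivAt_pderiv' ((hwd.differentiableOn (by norm_num)).differentiableAt hn)
      i).comp_hasDerivAt (hasDerivAt_abs_rpow_mul_self hq (w x))
    have hux := hasLineDerivAt_pderiv' (hud1.differentiableAt hn) i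
    have hvx := hasLineDerivAt_pderiv' (hvd1.differentiableAt hn) i
    have hux' := hasLineDerivAt_pderiv'
      ((hu1d.differentiableOn one_ne_zero).differentiableAt hn) i
    have hvx' := hasLineDerivAt_pderiv'
      ((hv1d.differentiableOn one_ne_zero).differentiableAt hn) i
    have h2 : HasLineDerivAt ℝ J _ x (EuclideanSpace.single i 1) :=
      ((hux.mul_real hvx').sub_real (hvx.mul_real hux')).comp_hasDerivAt
        (φ := fun s => c * s) (φ' := c) (by simpa using (hasDerivAt_id _).const_mul c)
    convert h1.mul_real h2 using 1
    rw [← hwJ x hx]; simp only [hL]; ring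
  have hC' : C ≤ C + P * (|c| * C) * Q + (q - 1) * (P * Q ^ 2) + P * (|c| * C) * (Q * C) := by
    have : 0 ≤ (q - 1) * (P * Q ^ 2) := mul_nonneg (by linarith) (by positivity)
    have : 0 ≤ P * (|c| * C) * Q := by positivity
    have : 0 ≤ P * (|c| * C) * (Q * C) := by positivity
    linarith
  have key := setIntegral_pderiv'_eq_zero hΩ hb (u := u)
    (f := fun x => |w x| ^ (q - 2) * w x * J x) (i := i)
    (C := C + P * (|c| * C) * Q + (q - 1) * (P * Q ^ 2) + P * (|c| * C) * (Q * C))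
    hud1 (fun x hx => (hfd x hx).differentiableWithinAt) hu1d.continuousOn
    (((hAc.const_smul (q - 1)).add hBc).congr hf') hpos (hC.trans hC')
    (fun x hx => (hud x hx).trans (mul_le_mul_of_nonneg_right hC' Metric.infDist_nonneg))
    (fun x hx => by
      have h1 : |(|w x| ^ (q - 2) * w x * J x)| ≤ P * (|c| * C) * (Q * u x) := by
        rw [abs_mul]
        exact mul_le_mul (hφb x hx) (hJb x hx) (abs_nonneg _) (by positivity)
      refine h1.trans ?_
      rw [← mul_assoc]
      refine mul_le_mul_of_nonneg_right ?_ (hpos x hx).le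
      have : 0 ≤ (q - 1) * (P * Q ^ 2) := mul_nonneg (by linarith) (by positivity)
      have : 0 ≤ P * (|c| * C) * (Q * C) := by positivity
      linarith)
    (fun x hx => (hub x hx).trans hC') (fun x hx => (hu1 x hx).trans hC')
    (fun x hx => by
      rw [hf' x hx]
      refine (abs_add_le _ _).trans ?_
      rw [abs_mul, abs_of_nonneg (show 0 ≤ q - 1 by linarith)]
      have h1 := mul_le_mul_of_nonneg_left (hAb x hx) (show 0 ≤ q - 1 by linarith)
      have h2 := hBb x hx
      have : 0 ≤ P * (|c| * C) * Q := by positivity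
      linarith)
  rw [setIntegral_congr_fun hΩ.measurableSet hf', integral_add (hAi.const_mul _) hBi,
    integral_const_mul] at key
  linarith

/-- Integration by parts identity for `w = c v / u`, tested against `|w|^(q-2) w`. -/
theorem setIntegral_flux {n : ℕ} {Ω : Set (EuclideanSpace ℝ (Fin n))}
    (hΩ : IsOpen Ω) (hb : Bornology.IsBounded Ω) {u v : EuclideanSpace ℝ (Fin n) → ℝ}
    (hu : ContDiffOn ℝ 2 u Ω) (hv : ContDiffOn ℝ 2 v Ω) {q : ℝ} (hq : 2 ≤ q) (c : ℝ)
    (hpos : ∀ x ∈ Ω, 0 < u x) {C : ℝ} (hC : 0 ≤ C)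
    (hud : ∀ x ∈ Ω, u x ≤ C * Metric.infDist x Ωᶜ)
    (hvu : ∀ x ∈ Ω, |v x| ≤ C * u x) (hub : ∀ x ∈ Ω, u x ≤ C)
    (hu1 : ∀ i, ∀ x ∈ Ω, |pderiv' i u x| ≤ C) (hv1 : ∀ i, ∀ x ∈ Ω, |pderiv' i v x| ≤ C)
    (hu2 : ∀ i, ∀ x ∈ Ω, |pderiv' i (pderiv' i u) x| ≤ C)
    (hv2 : ∀ i, ∀ x ∈ Ω, |pderiv' i (pderiv' i v) x| ≤ C) :
    IntegrableOn (fun x => |c * (v x / u x)| ^ (q - 2) * (c * (v x / u x)) *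
      (c * (u x * lap v x - v x * lap u x))) Ω ∧
    (q - 1) * ∫ x in Ω, |c * (v x / u x)| ^ (q - 2) *
      ‖gradient (fun y => c * (v y / u y)) x‖ ^ 2 * u x ^ 2 =
    -∫ x in Ω, |c * (v x / u x)| ^ (q - 2) * (c * (v x / u x)) *
      (c * (u x * lap v x - v x * lap u x)) := by
  have key := fun i => setIntegral_coord_flux hΩ hb hu hv hq c hpos hC hud hvu hub i
    (hu1 i) (hv1 i) (hu2 i) (hv2 i)
  have h1 : ∀ x, |c * (v x / u x)| ^ (q - 2) *
      ‖gradient (fun y => c * (v y / u y)) x‖ ^ 2 * u x ^ 2 =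
      ∑ i, |c * (v x / u x)| ^ (q - 2) *
        pderiv' i (fun y => c * (v y / u y)) x ^ 2 * u x ^ 2 := fun x => by
    rw [norm_gradient_sq_eq_sum, Finset.mul_sum, Finset.sum_mul]
  have h2 : ∀ x, |c * (v x / u x)| ^ (q - 2) * (c * (v x / u x)) *
      (c * (u x * lap v x - v x * lap u x)) =
      ∑ i, |c * (v x / u x)| ^ (q - 2) * (c * (v x / u x)) *
      (c * (u x * pderiv' i (pderiv' i v) x - v x * pderiv' i (pderiv' i u) x)) := fun x => by
    simp only [lap, Finset.mul_sum, ← Finset.sum_sub_distrib]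
  simp only [h1, h2]
  refine ⟨integrable_finsetSum _ fun i _ => (key i).2.1, ?_⟩
  rw [integral_finsetSum _ fun i _ => (key i).1, integral_finsetSum _ fun i _ => (key i).2.1,
    Finset.mul_sum, ← Finset.sum_neg_distrib]
  exact Finset.sum_congr rfl fun i _ => (key i).2.2

/-- Time differentiation commutes with a space derivative. -/
theorem hasDerivAt_pderiv'_of_hasDerivAt {n : ℕ} {Ω : Set (EuclideanSpace ℝ (Fin n))}
    (hΩ : IsOpen Ω) {a b : ℝ} {f g : EuclideanSpace ℝ (Fin n) → ℝ → ℝ}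
    (hf : ∀ t ∈ Ioo a b, DifferentiableOn ℝ (fun y => f y t) Ω)
    (hg : ∀ t ∈ Ioo a b, DifferentiableOn ℝ (fun y => g y t) Ω)
    (hfg : ∀ x ∈ Ω, ∀ t ∈ Ioo a b, HasDerivAt (f x) (g x t) t)
    (hgc : ∀ x ∈ Ω, ContinuousOn (g x) (Ioo a b)) (i : Fin n) {K : ℝ}
    (hK : ∀ x ∈ Ω, ∀ t ∈ Ioo a b, |pderiv' i (fun y => g y t) x| ≤ K)
    (hgi : ∀ x ∈ Ω, ContinuousOn (fun t => pderiv' i (fun y => g y t) x) (Ioo a b))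
    {x : EuclideanSpace ℝ (Fin n)} (hx : x ∈ Ω) {t : ℝ} (ht : t ∈ Ioo a b) :
    HasDerivAt (fun s => pderiv' i (fun y => f y s) x) (pderiv' i (fun y => g y t) x) t := by
  set e : EuclideanSpace ℝ (Fin n) := EuclideanSpace.single i 1 with he
  have hmem : {σ : ℝ | x + σ • e ∈ Ω} ∈ 𝓝 (0 : ℝ) := by
    have hc : Continuous fun σ : ℝ => x + σ • e := by fun_prop
    exact hc.continuousAt.preimage_mem_nhds (by simpa using hΩ.mem_nhds hx)
  have hx0 : x + (0 : ℝ) • e ∈ Ω := by simpa using hx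
  have hline : ∀ F : EuclideanSpace ℝ (Fin n) → ℝ, DifferentiableOn ℝ F Ω → ∀ σ : ℝ,
      x + σ • e ∈ Ω → HasDerivAt (fun σ => F (x + σ • e)) (pderiv' i F (x + σ • e)) σ := by
    intro F hF σ hσ
    have h1 : HasDerivAt (fun σ : ℝ => x + σ • e) e σ := by
      simpa using ((hasDerivAt_id σ).smul_const e).const_add x
    exact (hF.differentiableAt (hΩ.mem_nhds hσ)).hasFDerivAt.comp_hasDerivAt σ h1
  have hint : ∀ s ∈ Ioo a b, pderiv' i (fun y => f y s) x =
      pderiv' i (fun y => f y t) x + ∫ τ in t..s, pderiv' i (fun y => g y τ) x := by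
    intro s hs
    have hsub : uIcc t s ⊆ Ioo a b := ordConnected_Ioo.uIcc_subset ht hs
    have hsub' : uIoc t s ⊆ Ioo a b := uIoc_subset_uIcc.trans hsub
    have h1 := (intervalIntegral.hasDerivAt_integral_of_dominated_loc_of_deriv_le (μ := volume)
      (a := t) (b := s) (F := fun σ τ => g (x + σ • e) τ)
      (F' := fun σ τ => pderiv' i (fun y => g y τ) (x + σ • e)) (x₀ := (0 : ℝ))
      (bound := fun _ => K) hmem
      (Filter.eventually_of_mem hmem fun σ hσ =>
        ((hgc _ hσ).mono hsub').aestronglyMeasurable measurableSet_uIoc)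
      (((hgc _ hx0).mono hsub).intervalIntegrable)
      (((hgi _ hx0).mono hsub').aestronglyMeasurable measurableSet_uIoc)
      (ae_of_all _ fun τ hτ σ hσ => hK _ hσ τ (hsub' hτ)) intervalIntegrable_const
      (ae_of_all _ fun τ hτ σ hσ => hline _ (hg τ (hsub' hτ)) σ hσ)).2
    have h2 := (hline _ (hf s hs) 0 hx0).sub
      (hline _ (hf t ht) 0 hx0)
    have h3 : (fun σ : ℝ => ∫ τ in t..s, g (x + σ • e) τ) =ᶠ[𝓝 0]
        fun σ => f (x + σ • e) s - f (x + σ • e) t := by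
      filter_upwards [hmem] with σ hσ
      exact intervalIntegral.integral_eq_sub_of_hasDerivAt (fun τ hτ => hfg _ hσ τ (hsub hτ))
        (((hgc _ hσ).mono hsub).intervalIntegrable)
    have h4 := h1.unique (h2.congr_of_eventuallyEq h3)
    simp only [zero_smul, add_zero] at h4
    rw [h4]; ring
  have hFTC : HasDerivAt (fun s => ∫ τ in t..s, pderiv' i (fun y => g y τ) x)
      (pderiv' i (fun y => g y t) x) t :=
    intervalIntegral.integral_hasDerivAt_right (by simp)
      ((hgi x hx).stronglyMeasurableAtFilter isOpen_Ioo t ht)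
      ((hgi x hx).continuousAt (isOpen_Ioo.mem_nhds ht))
  refine (hFTC.const_add (pderiv' i (fun y => f y t) x)).congr_of_eventuallyEq ?_
  filter_upwards [isOpen_Ioo.mem_nhds ht] with s hs using hint s hs

/-- The time derivative of a function vanishing at a boundary point for all times vanishes there. -/
theorem timeDeriv_eq_zero_of_eq_zero {n : ℕ} {Ω : Set (EuclideanSpace ℝ (Fin n))} {T : ℝ}
    {u v : EuclideanSpace ℝ (Fin n) → ℝ → ℝ}
    (huc : ContinuousOn (fun z : EuclideanSpace ℝ (Fin n) × ℝ => u z.1 z.2)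
      (closure Ω ×ˢ Icc 0 T))
    (hvc : ContinuousOn (fun z : EuclideanSpace ℝ (Fin n) × ℝ => v z.1 z.2)
      (closure Ω ×ˢ Icc 0 T))
    (huv : ∀ x ∈ Ω, ∀ t ∈ Ioo 0 T, HasDerivAt (u x) (v x t) t)
    {y : EuclideanSpace ℝ (Fin n)} (hy : y ∈ closure Ω) (h0 : ∀ t ∈ Icc 0 T, u y t = 0)
    {t : ℝ} (ht : t ∈ Ioo 0 T) : v y t = 0 := by
  by_contra hne
  set m := |v y t| / 2 with hm
  have hm0 : 0 < m := half_pos (abs_pos.2 hne)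
  have htc : t ∈ Icc 0 T := Ioo_subset_Icc_self ht
  obtain ⟨δ, hδ, hδv⟩ := Metric.continuousWithinAt_iff.1 (hvc (y, t) ⟨hy, htc⟩) m hm0
  set h := min (δ / 2) ((T - t) / 2) with hh
  have hh0 : 0 < h := lt_min (half_pos hδ) (half_pos (sub_pos.2 ht.2))
  have hhδ : h < δ := (min_le_left _ _).trans_lt (half_lt_self hδ)
  have hhT : t + h < T := by
    have := min_le_right (δ / 2) ((T - t) / 2)
    linarith [ht.2]
  have hest : ∀ x ∈ Ω, dist x y < δ → |u x (t + h) - u x t - v y t * h| ≤ m * h := by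
    intro x hx hxy
    have hsub : Icc t (t + h) ⊆ Ioo 0 T := fun s hs =>
      ⟨ht.1.trans_le hs.1, hs.2.trans_lt hhT⟩
    have h1 := norm_image_sub_le_of_norm_deriv_le_segment' (f := fun s => u x s - v y t * s)
      (f' := fun s => v x s - v y t) (a := t) (b := t + h) (C := m)
      (fun s hs => ((huv x hx s (hsub hs)).sub
        (by simpa using (hasDerivAt_id s).const_mul (v y t))).hasDerivWithinAt)
      (fun s hs => by
        have hs' : s ∈ Icc t (t + h) := Ico_subset_Icc_self hs
        refine (hδv (x := (x, s)) ⟨subset_closure hx, Ioo_subset_Icc_self (hsub hs')⟩ ?_).le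
        rw [Prod.dist_eq, max_lt_iff]
        refine ⟨hxy, ?_⟩
        rw [Real.dist_eq, abs_of_nonneg (sub_nonneg.2 hs'.1)]
        linarith [hs'.2])
      (t + h) (right_mem_Icc.2 (by linarith))
    simp only [Real.norm_eq_abs, add_sub_cancel_left] at h1
    calc _ = |u x (t + h) - v y t * (t + h) - (u x t - v y t * t)| := by ring_nf
      _ ≤ _ := h1
  have : (𝓝[Ω] y).NeBot := mem_closure_iff_nhdsWithin_neBot.1 hy
  have htend : ∀ s ∈ Icc 0 T, Tendsto (fun x => u x s) (𝓝[Ω] y) (𝓝 0) := by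
    intro s hs
    have h1 : ContinuousWithinAt (fun x => u x s) (closure Ω) y :=
      (huc (y, s) ⟨hy, hs⟩).comp (f := fun x => (x, s)) (by fun_prop) fun x hx => ⟨hx, hs⟩
    have h2 := h1.mono subset_closure
    rw [ContinuousWithinAt, h0 s hs] at h2
    exact h2
  have hlim := (((htend (t + h) ⟨by linarith [ht.1], hhT.le⟩).sub (htend t htc)).sub_const
    (v y t * h)).abs
  have hle : |(0 : ℝ) - 0 - v y t * h| ≤ m * h := by
    refine le_of_tendsto hlim ?_
    filter_upwards [self_mem_nhdsWithin, mem_nhdsWithin_of_mem_nhds (Metric.ball_mem_nhds y hδ)]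
      with x hx hxy using hest x hx hxy
  rw [sub_zero, zero_sub, abs_neg, abs_mul, abs_of_pos hh0] at hle
  have := le_of_mul_le_mul_right hle hh0
  have := abs_pos.2 hne
  linarith

theorem abs_le_mul_infDist_compl {n : ℕ} {Ω : Set (EuclideanSpace ℝ (Fin n))}
    (hΩ : IsOpen Ω) (huniv : Ω ≠ univ) {v : EuclideanSpace ℝ (Fin n) → ℝ}
    (hv : DifferentiableOn ℝ v Ω) (hvc : ContinuousOn v (closure Ω))
    (h0 : ∀ y ∈ frontier Ω, v y = 0) {C : ℝ} (hC : 0 ≤ C)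
    (hv1 : ∀ i, ∀ x ∈ Ω, |pderiv' i v x| ≤ C) {x : EuclideanSpace ℝ (Fin n)} (hx : x ∈ Ω) :
    |v x| ≤ n * C * Metric.infDist x Ωᶜ := by
  obtain ⟨y, hy, hxy⟩ := exists_mem_frontier_infDist_compl_eq_dist hx huniv
  have hyΩ : y ∉ Ω := fun h => hΩ.inter_frontier_eq.subset ⟨h, hy⟩
  have hd0 : dist x y ≠ 0 := fun h => hyΩ (dist_eq_zero.1 h ▸ hx)
  set r := Metric.infDist x Ωᶜ with hr
  have hball : Metric.ball x r ⊆ Ω := Metric.ball_infDist_compl_subset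
  have hnorm : ∀ z ∈ Ω, ‖fderiv ℝ v z‖ ≤ n * C := by
    intro z hz
    have h1 : ‖gradient v z‖ = ‖fderiv ℝ v z‖ := LinearIsometryEquiv.norm_map _ _
    rw [← h1]
    refine (sq_le_sq₀ (norm_nonneg _) (by positivity)).1 ?_
    rw [norm_gradient_sq_eq_sum]
    have h2 : ∀ i, pderiv' i v z ^ 2 ≤ C ^ 2 := fun i => sq_le_sq' (abs_le.1 (hv1 i z hz)).1
      (abs_le.1 (hv1 i z hz)).2
    calc _ ≤ ∑ _i : Fin n, C ^ 2 := Finset.sum_le_sum fun i _ => h2 i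
      _ = n * C ^ 2 := by simp
      _ ≤ (n : ℝ) ^ 2 * C ^ 2 := by
        refine mul_le_mul_of_nonneg_right ?_ (sq_nonneg C)
        exact_mod_cast Nat.le_self_pow two_ne_zero n
      _ = _ := by ring
  have hlip : LipschitzOnWith (Real.toNNReal (n * C)) v (Metric.ball x r) := by
    refine (convex_ball x r).lipschitzOnWith_of_nnnorm_fderiv_le (𝕜 := ℝ)
      (fun z hz => hv.differentiableAt (hΩ.mem_nhds (hball hz))) fun z hz => ?_
    rw [← NNReal.coe_le_coe, coe_nnnorm, Real.coe_toNNReal _ (by positivity)]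
    exact hnorm z (hball hz)
  have hlip' := hlip.closure (hvc.mono (closure_mono hball))
  have hrpos : r ≠ 0 := by rw [hxy]; exact hd0
  have hcl : closure (Metric.ball x r) = Metric.closedBall x r := closure_ball x hrpos
  rw [hcl] at hlip'
  have := hlip'.dist_le_mul x (Metric.mem_closedBall_self Metric.infDist_nonneg) y
    (by rw [Metric.mem_closedBall, dist_comm, hxy])
  rwa [h0 y hy, Real.dist_eq, sub_zero, Real.coe_toNNReal _ (by positivity), ← hxy] at this

theorem exists_abs_le_of_continuousOn {n : ℕ} {Ω : Set (EuclideanSpace ℝ (Fin n))}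
    (hb : Bornology.IsBounded Ω) {T : ℝ} {f : EuclideanSpace ℝ (Fin n) → ℝ → ℝ}
    (hf : ContinuousOn (fun z : EuclideanSpace ℝ (Fin n) × ℝ => f z.1 z.2)
      (closure Ω ×ˢ Icc 0 T)) :
    ∃ K : ℝ, 0 ≤ K ∧ ∀ x ∈ Ω, ∀ t ∈ Icc 0 T, |f x t| ≤ K := by
  obtain ⟨K, hK⟩ := (hb.isCompact_closure.prod isCompact_Icc).exists_bound_of_continuousOn hf
  exact ⟨max K 0, le_max_right _ _, fun x hx t ht =>
    (hK (x, t) ⟨subset_closure hx, ht⟩).trans (le_max_left _ _)⟩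

theorem ExtendsCont.exists_abs_le {n : ℕ} {Ω : Set (EuclideanSpace ℝ (Fin n))}
    (hb : Bornology.IsBounded Ω) {T : ℝ} {f : Fin n → EuclideanSpace ℝ (Fin n) → ℝ → ℝ}
    (hf : ∀ i, ExtendsCont Ω T (f i)) :
    ∃ K : ℝ, 0 ≤ K ∧ ∀ i, ∀ x ∈ Ω, ∀ t ∈ Icc 0 T, |f i x t| ≤ K := by
  have h1 : ∀ i, ∃ K : ℝ, 0 ≤ K ∧ ∀ x ∈ Ω, ∀ t ∈ Icc 0 T, |f i x t| ≤ K := fun i => by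
    obtain ⟨g, hg, hgf⟩ := hf i
    obtain ⟨K, hK0, hK⟩ := exists_abs_le_of_continuousOn hb hg
    exact ⟨K, hK0, fun x hx t ht => hgf x hx t ht ▸ hK x hx t ht⟩
  choose K hK0 hK using h1
  exact ⟨∑ i, K i, Finset.sum_nonneg fun i _ => hK0 i, fun i x hx t ht =>
    (hK i x hx t ht).trans (Finset.single_le_sum (fun j _ => hK0 j) (Finset.mem_univ i))⟩

theorem ExtendsCont.continuousOn_time {n : ℕ} {Ω : Set (EuclideanSpace ℝ (Fin n))} {T : ℝ}
    {f : EuclideanSpace ℝ (Fin n) → ℝ → ℝ} (hf : ExtendsCont Ω T f)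
    {x : EuclideanSpace ℝ (Fin n)} (hx : x ∈ Ω) : ContinuousOn (f x) (Icc 0 T) := by
  obtain ⟨g, hg, hgf⟩ := hf
  have h1 : ContinuousOn (g x) (Icc 0 T) :=
    hg.comp (f := fun t => (x, t)) (by fun_prop) fun t ht => ⟨subset_closure hx, ht⟩
  exact h1.congr fun t ht => (hgf x hx t ht).symm

theorem moment_integrand_identity {p q c u v utt L M w : ℝ} (hp : 1 < p) (hu : 0 < u)
    (hq : 2 ≤ q) (hw : w = -p * (v / u))
    (hL : L = p * (u ^ (p - 1) * v) - c * u - u ^ p)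
    (hM : M = p * ((p - 1) * u ^ (p - 2) * v * v + u ^ (p - 1) * utt) - c * v -
      p * u ^ (p - 1) * v) :
    q * |w| ^ (q - 2) * w * (-p * ((utt * u - v * v) / u ^ 2)) * u ^ (p + 1) +
        |w| ^ q * (v * (p + 1) * u ^ p) =
      q / p * (|w| ^ (q - 2) * w * (-p * (u * M - v * L))) +
        ((p - 1) / p * (q - (p + 1) / (p - 1)) * (|w| ^ q * w) + (q - q / p) * |w| ^ q) *
          u ^ (p + 1) := by
  have h1 : |w| ^ q = |w| ^ (q - 2) * w ^ 2 := by
    rw [← sq_abs w, ← Real.rpow_natCast |w| 2, ← Real.rpow_add' (abs_nonneg w)]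
    · norm_num
    · norm_num; linarith
  have h2 : u ^ p = u ^ (p - 1) * u := by rw [← Real.rpow_add_one hu.ne']; ring_nf
  have h3 : u ^ (p + 1) = u ^ (p - 1) * u ^ 2 := by
    rw [Real.rpow_add_one hu.ne', h2]; ring
  have h4 : u ^ (p - 2) = u ^ (p - 1) / u := by
    rw [eq_div_iff hu.ne', ← Real.rpow_add_one hu.ne']; ring_nf
  have hp0 : p ≠ 0 := by linarith
  have hp1 : p - 1 ≠ 0 := by linarith
  have hv : v = -(u * w / p) := by rw [hw]; field_simp
  rw [hM, hL, h1, h4, h3, h2]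
  generalize |w| ^ (q - 2) = A
  generalize u ^ (p - 1) = U
  clear hw
  subst hv
  field_simp
  ring

theorem hasDerivAt_setIntegral_moment {n : ℕ} {Ω : Set (EuclideanSpace ℝ (Fin n))}
    (hΩ : IsOpen Ω) (hb : Bornology.IsBounded Ω) {T p q : ℝ} (hp : 1 < p) (hq : 2 ≤ q)
    {u v vt : EuclideanSpace ℝ (Fin n) → ℝ → ℝ}
    (huc : ∀ t ∈ Ioo 0 T, ContinuousOn (fun x => u x t) Ω)
    (hvc : ∀ t ∈ Ioo 0 T, ContinuousOn (fun x => v x t) Ω)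
    (hvtc : ∀ t ∈ Ioo 0 T, ContinuousOn (fun x => vt x t) Ω)
    (hpos : ∀ x ∈ Ω, ∀ t ∈ Ioo 0 T, 0 < u x t)
    (huv : ∀ x ∈ Ω, ∀ t ∈ Ioo 0 T, HasDerivAt (u x) (v x t) t)
    (hvvt : ∀ x ∈ Ω, ∀ t ∈ Ioo 0 T, HasDerivAt (v x) (vt x t) t)
    {C : ℝ} (hC : 0 ≤ C) (hub : ∀ x ∈ Ω, ∀ t ∈ Ioo 0 T, u x t ≤ C)
    (hvu : ∀ x ∈ Ω, ∀ t ∈ Ioo 0 T, |v x t| ≤ C * u x t)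
    (hvtb : ∀ x ∈ Ω, ∀ t ∈ Ioo 0 T, |vt x t| ≤ C) {t : ℝ} (ht : t ∈ Ioo 0 T) :
    IntegrableOn (fun x =>
      q * |-p * (v x t / u x t)| ^ (q - 2) * (-p * (v x t / u x t)) *
          (-p * ((vt x t * u x t - v x t * v x t) / u x t ^ 2)) * u x t ^ (p + 1) +
        |-p * (v x t / u x t)| ^ q * (v x t * (p + 1) * u x t ^ p)) Ω ∧
    HasDerivAt (fun s => ∫ x in Ω, |-p * (v x s / u x s)| ^ q * u x s ^ (p + 1))
      (∫ x in Ω, (q * |-p * (v x t / u x t)| ^ (q - 2) * (-p * (v x t / u x t)) *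
          (-p * ((vt x t * u x t - v x t * v x t) / u x t ^ 2)) * u x t ^ (p + 1) +
        |-p * (v x t / u x t)| ^ q * (v x t * (p + 1) * u x t ^ p))) t := by
  have hwc : ∀ s ∈ Ioo 0 T, ContinuousOn (fun x => -p * (v x s / u x s)) Ω := fun s hs =>
    continuousOn_const.mul ((hvc s hs).div (huc s hs) fun x hx => (hpos x hx s hs).ne')
  have hupow : ∀ r : ℝ, ∀ s ∈ Ioo 0 T, ContinuousOn (fun x => u x s ^ r) Ω := fun r s hs =>
    (huc s hs).rpow_const fun x hx => Or.inl (hpos x hx s hs).ne'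
  have hFc : ∀ s ∈ Ioo 0 T,
      ContinuousOn (fun x => |-p * (v x s / u x s)| ^ q * u x s ^ (p + 1)) Ω := fun s hs =>
    ((hwc s hs).abs.rpow_const fun _ _ => Or.inr (by linarith)).mul (hupow _ s hs)
  have hF'c : ContinuousOn (fun x =>
      q * |-p * (v x t / u x t)| ^ (q - 2) * (-p * (v x t / u x t)) *
          (-p * ((vt x t * u x t - v x t * v x t) / u x t ^ 2)) * u x t ^ (p + 1) +
        |-p * (v x t / u x t)| ^ q * (v x t * (p + 1) * u x t ^ p)) Ω :=
    ((((continuousOn_const.mul ((hwc t ht).abs.rpow_const fun _ _ => Or.inr (by linarith))).mul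
      (hwc t ht)).mul (continuousOn_const.mul ((((hvtc t ht).mul (huc t ht)).sub
        ((hvc t ht).mul (hvc t ht))).div ((huc t ht).pow 2)
          fun x hx => (pow_pos (hpos x hx t ht) 2).ne'))).mul (hupow _ t ht)).add
      (((hwc t ht).abs.rpow_const fun _ _ => Or.inr (by linarith)).mul
        (((hvc t ht).mul continuousOn_const).mul (hupow _ t ht)))
  set W := p * C with hW
  have hW0 : 0 ≤ W := by positivity
  have hwb : ∀ x ∈ Ω, ∀ s ∈ Ioo 0 T, |-p * (v x s / u x s)| ≤ W := by
    intro x hx s hs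
    rw [abs_mul, abs_neg, abs_of_pos (by linarith : 0 < p), abs_div, abs_of_pos (hpos x hx s hs)]
    refine mul_le_mul_of_nonneg_left ?_ (by linarith)
    rw [div_le_iff₀ (hpos x hx s hs)]; exact hvu x hx s hs
  have hub' : ∀ r : ℝ, 0 ≤ r → ∀ x ∈ Ω, ∀ s ∈ Ioo 0 T, u x s ^ r ≤ C ^ r :=
    fun r hr x hx s hs => Real.rpow_le_rpow (hpos x hx s hs).le (hub x hx s hs) hr
  have hFb : ∀ x ∈ Ω, |(|-p * (v x t / u x t)| ^ q * u x t ^ (p + 1))| ≤ W ^ q * C ^ (p + 1) := by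
    intro x hx
    have hu := hpos x hx t ht
    rw [abs_of_nonneg (by positivity)]
    exact mul_le_mul (Real.rpow_le_rpow (abs_nonneg _) (hwb x hx t ht) (by linarith))
      (hub' _ (by linarith) x hx t ht) (by positivity) (by positivity)
  have hF'b : ∀ x ∈ Ω, ∀ s ∈ Ioo 0 T,
      |q * |-p * (v x s / u x s)| ^ (q - 2) * (-p * (v x s / u x s)) *
          (-p * ((vt x s * u x s - v x s * v x s) / u x s ^ 2)) * u x s ^ (p + 1) +
        |-p * (v x s / u x s)| ^ q * (v x s * (p + 1) * u x s ^ p)| ≤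
      q * W ^ (q - 2) * W * (p * (C * C + C * C * (C * C)) * C ^ (p - 1)) +
        W ^ q * (C * C * (p + 1) * C ^ p) := by
    intro x hx s hs
    have hu := hpos x hx s hs
    have hvb : |v x s| ≤ C * C :=
      (hvu x hx s hs).trans (mul_le_mul_of_nonneg_left (hub x hx s hs) hC)
    have hw1 : |-p * (v x s / u x s)| ^ (q - 2) ≤ W ^ (q - 2) :=
      Real.rpow_le_rpow (abs_nonneg _) (hwb x hx s hs) (by linarith)
    refine (abs_add_le _ _).trans (add_le_add ?_ ?_)
    · have h1 : (-p * ((vt x s * u x s - v x s * v x s) / u x s ^ 2)) * u x s ^ (p + 1) =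
          -p * (vt x s * u x s - v x s * v x s) * u x s ^ (p - 1) := by
        have : u x s ^ (p + 1) = u x s ^ (p - 1) * u x s ^ 2 := by
          rw [← Real.rpow_natCast (u x s) 2, ← Real.rpow_add hu]; norm_num; ring_nf
        rw [this]; field_simp
      have h2 : |vt x s * u x s - v x s * v x s| ≤ C * C + C * C * (C * C) := by
        refine (abs_sub _ _).trans (add_le_add ?_ ?_)
        · rw [abs_mul, abs_of_pos hu]
          exact mul_le_mul (hvtb x hx s hs) (hub x hx s hs) hu.le hC
        · rw [abs_mul]
          exact mul_le_mul hvb hvb (abs_nonneg _) (by positivity)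
      have h3 := hub' (p - 1) (by linarith) x hx s hs
      have h4 := hwb x hx s hs
      rw [mul_assoc, h1]
      generalize -p * (v x s / u x s) = w at h4 hw1 ⊢
      rw [abs_mul, abs_mul, abs_mul, abs_mul, abs_mul, abs_neg,
        abs_of_pos (by linarith : 0 < q), abs_of_pos (by linarith : 0 < p),
        abs_of_nonneg (by positivity : 0 ≤ u x s ^ (p - 1)),
        abs_of_nonneg (by positivity : 0 ≤ |w| ^ (q - 2))]
      have hq0 : 0 ≤ q := by linarith
      have hp0 : 0 ≤ p := by linarith
      gcongr
    · have h3 := hub' p (by linarith) x hx s hs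
      have h4 := hwb x hx s hs
      generalize -p * (v x s / u x s) = w at h4 ⊢
      rw [abs_mul, abs_mul, abs_mul, abs_of_nonneg (by linarith : 0 ≤ p + 1),
        abs_of_nonneg (by positivity : 0 ≤ u x s ^ p),
        abs_of_nonneg (by positivity : 0 ≤ |w| ^ q)]
      have hp0 : 0 ≤ p := by linarith
      have hq0 : 0 ≤ q := by linarith
      gcongr
  refine hasDerivAt_integral_of_dominated_loc_of_deriv_le (μ := volume.restrict Ω)
    (F := fun s x => |-p * (v x s / u x s)| ^ q * u x s ^ (p + 1))
    (F' := fun s x => q * |-p * (v x s / u x s)| ^ (q - 2) * (-p * (v x s / u x s)) *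
          (-p * ((vt x s * u x s - v x s * v x s) / u x s ^ 2)) * u x s ^ (p + 1) +
        |-p * (v x s / u x s)| ^ q * (v x s * (p + 1) * u x s ^ p))
    (isOpen_Ioo.mem_nhds ht)
    (Filter.eventually_of_mem (isOpen_Ioo.mem_nhds ht) fun s hs =>
      (hFc s hs).aestronglyMeasurable hΩ.measurableSet)
    (integrableOn_of_continuousOn_of_abs_le hΩ hb (hFc t ht) hFb)
    (hF'c.aestronglyMeasurable hΩ.measurableSet)
    (ae_restrict_of_forall_mem hΩ.measurableSet hF'b)
    (integrableOn_const (by exact hb.measure_lt_top.ne))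
    (ae_restrict_of_forall_mem hΩ.measurableSet fun x hx s hs => ?_)
  have hu := hpos x hx s hs
  have h1 := ((huv x hx s hs).rpow_const (p := p + 1) (Or.inl hu.ne'))
  have h2 := ((hvvt x hx s hs).fun_div (huv x hx s hs) hu.ne').const_mul (-p)
  have h3 := (hasDerivAt_abs_rpow (-p * (v x s / u x s)) (by linarith : 1 < q)).comp s h2
  have h4 := h3.mul h1
  refine h4.congr_deriv ?_
  simp only [add_sub_cancel_right, Function.comp]

/-- The pointwise form of the equation: the curvature-like quantity in terms of `∂ₜ u`, and the
formulas for the Laplacians of `u` and of `∂ₜ u`. -/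
theorem FDSetting.pointwise {n : ℕ} {Ω : Set (EuclideanSpace ℝ (Fin n))} {p b T c₀ : ℝ}
    {u ut utt : EuclideanSpace ℝ (Fin n) → ℝ → ℝ} (h : FDSetting Ω p b T c₀ u ut utt)
    {x : EuclideanSpace ℝ (Fin n)} (hx : x ∈ Ω) {t : ℝ} (ht : t ∈ Ioo 0 T) :
    lap (fun y => u y t) x = p * (u x t ^ (p - 1) * ut x t) - b * u x t - u x t ^ p ∧
    lap (fun y => ut y t) x = p * ((p - 1) * u x t ^ (p - 2) * ut x t * ut x t +
      u x t ^ (p - 1) * utt x t) - b * ut x t - p * u x t ^ (p - 1) * ut x t ∧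
    curvQ p b u x t - 1 = -p * (ut x t / u x t) := by
  obtain ⟨⟨hΩ, hb, -, -⟩, hp, -, hT, -, ⟨hu3, hut2, hut, hutt, -, hutc, -, -, hu2e, -, hut1e,
    hut2e⟩, hpos, hpde, -, -⟩ := h
  have hI : ∀ s ∈ Ioo 0 T, s ∈ Icc 0 T := fun s hs => Ioo_subset_Icc_self hs
  have hut' : ∀ x ∈ Ω, ∀ s ∈ Ioo 0 T, HasDerivAt (u x) (ut x s) s := fun x hx s hs =>
    (hut x hx s (hI s hs)).hasDerivAt (Icc_mem_nhds hs.1 hs.2)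
  have hutt' : ∀ s ∈ Ioo 0 T, HasDerivAt (ut x) (utt x s) s := fun s hs =>
    (hutt x hx s (hI s hs)).hasDerivAt (Icc_mem_nhds hs.1 hs.2)
  have hlap : ∀ s ∈ Ioo 0 T, lap (fun y => u y s) x =
      p * (u x s ^ (p - 1) * ut x s) - b * u x s - u x s ^ p := by
    intro s hs
    have h1 := (hpde x hx s ⟨hs.1, hs.2.le⟩).hasDerivAt (Icc_mem_nhds hs.1 hs.2)
    have h2 := (hut' x hx s hs).rpow_const (p := p) (Or.inl (hpos x hx s (hI s hs)).ne')
    have h3 := h1.unique h2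
    linarith
  have hu0 := hpos x hx t (hI t ht)
  refine ⟨hlap t ht, ?_, ?_⟩
  · obtain ⟨K1, -, hK1⟩ := ExtendsCont.exists_abs_le hb hut1e
    have hK2 := fun i => ExtendsCont.exists_abs_le hb (hut2e i)
    have hd1 : ∀ i, ∀ x ∈ Ω, ∀ s ∈ Ioo 0 T, HasDerivAt (fun s => pderiv' i (fun y => u y s) x)
        (pderiv' i (fun y => ut y s) x) s := fun i x hx s hs =>
      hasDerivAt_pderiv'_of_hasDerivAt hΩ
        (fun s hs => (hu3 s (hI s hs)).differentiableOn (by norm_num))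
        (fun s hs => (hut2 s (hI s hs)).differentiableOn (by norm_num)) hut'
        (fun x hx s hs => ((hutt x hx s (hI s hs)).continuousWithinAt.mono Ioo_subset_Icc_self))
        i (fun x hx s hs => hK1 i x hx s (hI s hs))
        (fun x hx => ((hut1e i).continuousOn_time hx).mono Ioo_subset_Icc_self) hx hs
    have hd2 : ∀ i, HasDerivAt (fun s => pderiv' i (pderiv' i fun y => u y s) x)
        (pderiv' i (pderiv' i fun y => ut y t) x) t := fun i => by
      obtain ⟨K2, -, hK2⟩ := hK2 i
      exact hasDerivAt_pderiv'_of_hasDerivAt hΩ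
        (f := fun x s => pderiv' i (fun y => u y s) x)
        (g := fun x s => pderiv' i (fun y => ut y s) x)
        (fun s hs => (contDiffOn_pderiv' hΩ (hu3 s (hI s hs)) (m := 1)
          (by norm_num) i).differentiableOn one_ne_zero)
        (fun s hs => (contDiffOn_pderiv' hΩ (hut2 s (hI s hs)) (m := 1)
          (by norm_num) i).differentiableOn one_ne_zero) (hd1 i)
        (fun x hx => ((hut1e i).continuousOn_time hx).mono Ioo_subset_Icc_self)
        i (fun x hx s hs => hK2 i x hx s (hI s hs))
        (fun x hx => ((hut2e i i).continuousOn_time hx).mono Ioo_subset_Icc_self) hx ht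
    have h1 : HasDerivAt (fun s => lap (fun y => u y s) x) (lap (fun y => ut y t) x) t :=
      HasDerivAt.fun_sum fun i _ => hd2 i
    have hut0 := hut' x hx t ht
    have h2 := ((((hut0.rpow_const (p := p - 1) (Or.inl hu0.ne')).mul
      (hutt' t ht)).const_mul p).sub (hut0.const_mul b)).sub
        (hut0.rpow_const (p := p) (Or.inl hu0.ne'))
    have h3 := h1.unique (h2.congr_of_eventuallyEq
      (Filter.eventually_of_mem (isOpen_Ioo.mem_nhds ht) hlap))
    rw [h3, show p - 1 - 1 = p - 2 by ring]
    ring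
  · rw [curvQ, hlap t ht]
    have h1 : u x t ^ (-p) * u x t ^ (p - 1) = (u x t)⁻¹ := by
      rw [← Real.rpow_add hu0, ← Real.rpow_neg_one]; ring_nf
    have h2 : u x t ^ (-p) * u x t ^ p = 1 := by
      rw [← Real.rpow_add hu0, neg_add_cancel, Real.rpow_zero]
    calc _ = -p * ut x t * (u x t ^ (-p) * u x t ^ (p - 1)) + u x t ^ (-p) * u x t ^ p - 1 := by
          ring
      _ = _ := by rw [h1, h2]; ring

/-- All the quantities entering the evolution identity are bounded by a common constant. -/
theorem FDSetting.exists_bound {n : ℕ} (hn : 1 ≤ n) {Ω : Set (EuclideanSpace ℝ (Fin n))}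
    {p b T c₀ : ℝ} {u ut utt : EuclideanSpace ℝ (Fin n) → ℝ → ℝ}
    (h : FDSetting Ω p b T c₀ u ut utt) :
    ∃ C : ℝ, 0 ≤ C ∧ ∀ x ∈ Ω, ∀ t ∈ Ioo 0 T,
      u x t ≤ C * Metric.infDist x Ωᶜ ∧ |ut x t| ≤ C * u x t ∧ u x t ≤ C ∧ |utt x t| ≤ C ∧
      ∀ i, |pderiv' i (fun y => u y t) x| ≤ C ∧ |pderiv' i (fun y => ut y t) x| ≤ C ∧
        |pderiv' i (pderiv' i fun y => u y t) x| ≤ C ∧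
        |pderiv' i (pderiv' i fun y => ut y t) x| ≤ C := by
  obtain ⟨⟨hΩ, hb, hne, -⟩, -, -, -, hc₀, ⟨-, hut2, hut, -, huc, hutc, huttc, hu1e, hu2e, -,
    hut1e, hut2e⟩, hpos, -, hbdry, hdist⟩ := h
  have hI : ∀ s ∈ Ioo 0 T, s ∈ Icc 0 T := fun s hs => Ioo_subset_Icc_self hs
  have : Nonempty (Fin n) := ⟨⟨0, hn⟩⟩
  have huniv : Ω ≠ univ := fun h => NormedSpace.unbounded_univ ℝ (EuclideanSpace ℝ (Fin n)) (h ▸ hb)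
  obtain ⟨K1, hK1, hu⟩ := exists_abs_le_of_continuousOn hb huc
  obtain ⟨K2, hK2, hutt⟩ := exists_abs_le_of_continuousOn hb huttc
  obtain ⟨K3, hK3, hu1⟩ := ExtendsCont.exists_abs_le hb hu1e
  obtain ⟨K4, hK4, hut1⟩ := ExtendsCont.exists_abs_le hb hut1e
  obtain ⟨K5, hK5, hu2⟩ := ExtendsCont.exists_abs_le hb fun i => hu2e i i
  obtain ⟨K6, hK6, hut2'⟩ := ExtendsCont.exists_abs_le hb fun i => hut2e i i
  have hc0 : 0 < c₀ := by linarith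
  have hK7 : 0 ≤ n * K4 * c₀ := by positivity
  refine ⟨K1 + K2 + K3 + K4 + K5 + K6 + n * K4 * c₀ + c₀, by positivity, fun x hx t ht => ?_⟩
  have hu0 := hpos x hx t (hI t ht)
  refine ⟨?_, ?_, ?_, ?_, fun i => ⟨?_, ?_, ?_, ?_⟩⟩
  · obtain ⟨y, hy, hxy⟩ := exists_mem_frontier_infDist_compl_eq_dist hx huniv
    calc u x t ≤ c₀ * dB Ω x := (hdist x hx t (hI t ht)).2
      _ ≤ c₀ * Metric.infDist x Ωᶜ := by
        rw [hxy]
        exact mul_le_mul_of_nonneg_left (Metric.infDist_le_dist_of_mem hy) hc0.le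
      _ ≤ _ := mul_le_mul_of_nonneg_right (by linarith) Metric.infDist_nonneg
  · have hv0 : ∀ y ∈ frontier Ω, ut y t = 0 := fun y hy =>
      timeDeriv_eq_zero_of_eq_zero huc hutc
        (fun x hx s hs => (hut x hx s (hI s hs)).hasDerivAt (Icc_mem_nhds hs.1 hs.2))
        (frontier_subset_closure hy) (hbdry y hy) ht
    have h1 := abs_le_mul_infDist_compl hΩ huniv
      ((hut2 t (hI t ht)).differentiableOn (by norm_num))
      (hutc.comp (f := fun x => (x, t)) (by fun_prop) fun x hx => ⟨hx, hI t ht⟩) hv0 hK4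
      (fun i x hx => hut1 i x hx t (hI t ht)) hx
    obtain ⟨y, hy, -⟩ := exists_mem_frontier_infDist_compl_eq_dist hx huniv
    have h2 : Metric.infDist x Ωᶜ ≤ dB Ω x :=
      Metric.infDist_le_infDist_of_subset (fun z hz hzΩ => hΩ.inter_frontier_eq.subset ⟨hzΩ, hz⟩)
        ⟨y, hy⟩
    have h3 : dB Ω x ≤ c₀ * u x t := (inv_mul_le_iff₀ hc0).1 (hdist x hx t (hI t ht)).1
    calc |ut x t| ≤ n * K4 * Metric.infDist x Ωᶜ := h1
      _ ≤ n * K4 * (c₀ * u x t) := mul_le_mul_of_nonneg_left (h2.trans h3) (by positivity)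
      _ = n * K4 * c₀ * u x t := by ring
      _ ≤ _ := mul_le_mul_of_nonneg_right (by linarith) hu0.le
  · linarith [(le_abs_self _).trans (hu x hx t (hI t ht))]
  · linarith [hutt x hx t (hI t ht)]
  · linarith [hu1 i x hx t (hI t ht)]
  · linarith [hut1 i x hx t (hI t ht)]
  · linarith [hu2 i x hx t (hI t ht)]
  · linarith [hut2' i x hx t (hI t ht)]

/-- The evolution identity (4.8) of the paper for the moments
`M_q(t) = ∫_Ω |𝓡 - 1|^q u^{p+1}` of the curvature-like quantity `𝓡`:
`M_q` is differentiable on `(0,T)` with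
`M_q' = -(q(q-1)/p) ∫ |𝓡-1|^{q-2} |∇(𝓡-1)|² u²
  + ∫ [ ((p-1)/p)(q-(p+1)/(p-1)) |𝓡-1|^q (𝓡-1) + (q - q/p) |𝓡-1|^q ] u^{p+1}`. -/
theorem stmt12 (n : ℕ) (hn : 1 ≤ n) (Ω : Set (EuclideanSpace ℝ (Fin n)))
    (p b c₀ T : ℝ) (q : ℝ) (hq : 2 ≤ q)
    (u ut utt : EuclideanSpace ℝ (Fin n) → ℝ → ℝ)
    (h : FDSetting Ω p b T c₀ u ut utt) :
    ∀ t ∈ Set.Ioo (0 : ℝ) T,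
      HasDerivAt
        (fun s => ∫ x in Ω, |curvQ p b u x s - 1| ^ q * u x s ^ (p + 1))
        (-(q * (q - 1) / p) *
            (∫ x in Ω, |curvQ p b u x t - 1| ^ (q - 2) *
              ‖gradient (fun y => curvQ p b u y t - 1) x‖ ^ 2 * u x t ^ 2) +
          ∫ x in Ω,
            ((p - 1) / p * (q - (p + 1) / (p - 1)) *
                (|curvQ p b u x t - 1| ^ q * (curvQ p b u x t - 1)) +
              (q - q / p) * |curvQ p b u x t - 1| ^ q) * u x t ^ (p + 1)) t := by
  intro t ht
  obtain ⟨C, hC, hbd⟩ := h.exists_bound hn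
  have hpt := fun x (hx : x ∈ Ω) s (hs : s ∈ Ioo 0 T) => h.pointwise hx hs
  obtain ⟨⟨hΩ, hb, -, -⟩, hp, -, -, -, ⟨hu3, hut2, hut, hutt, huc, hutc, huttc, -⟩, hpos, -⟩ := h
  have hI : ∀ s ∈ Ioo 0 T, s ∈ Icc 0 T := fun s hs => Ioo_subset_Icc_self hs
  have hslice : ∀ f : EuclideanSpace ℝ (Fin n) → ℝ → ℝ,
      ContinuousOn (fun z : EuclideanSpace ℝ (Fin n) × ℝ => f z.1 z.2) (closure Ω ×ˢ Icc 0 T) →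
      ∀ s ∈ Ioo 0 T, ContinuousOn (fun x => f x s) Ω := fun f hf s hs =>
    hf.comp (f := fun x => (x, s)) (by fun_prop) fun x hx => ⟨subset_closure hx, hI s hs⟩
  obtain ⟨hint, hder⟩ := hasDerivAt_setIntegral_moment hΩ hb hp hq (hslice u huc)
    (hslice ut hutc) (hslice utt huttc) (fun x hx s hs => hpos x hx s (hI s hs))
    (fun x hx s hs => (hut x hx s (hI s hs)).hasDerivAt (Icc_mem_nhds hs.1 hs.2))
    (fun x hx s hs => (hutt x hx s (hI s hs)).hasDerivAt (Icc_mem_nhds hs.1 hs.2)) hC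
    (fun x hx s hs => (hbd x hx s hs).2.2.1) (fun x hx s hs => (hbd x hx s hs).2.1)
    (fun x hx s hs => (hbd x hx s hs).2.2.2.1) ht
  obtain ⟨hflux, hparts⟩ := setIntegral_flux hΩ hb
    ((hu3 t (hI t ht)).of_le (by norm_num)) (hut2 t (hI t ht)) hq (-p)
    (fun x hx => hpos x hx t (hI t ht)) hC (fun x hx => (hbd x hx t ht).1)
    (fun x hx => (hbd x hx t ht).2.1) (fun x hx => (hbd x hx t ht).2.2.1)
    (fun i x hx => ((hbd x hx t ht).2.2.2.2 i).1) (fun i x hx => ((hbd x hx t ht).2.2.2.2 i).2.1)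
    (fun i x hx => ((hbd x hx t ht).2.2.2.2 i).2.2.1)
    (fun i x hx => ((hbd x hx t ht).2.2.2.2 i).2.2.2)
  have hmoment : (fun s => ∫ x in Ω, |curvQ p b u x s - 1| ^ q * u x s ^ (p + 1)) =ᶠ[𝓝 t]
      fun s => ∫ x in Ω, |-p * (ut x s / u x s)| ^ q * u x s ^ (p + 1) := by
    filter_upwards [isOpen_Ioo.mem_nhds ht] with s hs
    exact setIntegral_congr_fun hΩ.measurableSet fun x hx => by
      simp only [(hpt x hx s hs).2.2]
  refine (hder.congr_of_eventuallyEq hmoment).congr_deriv ?_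
  have hgrad : ∫ x in Ω, |curvQ p b u x t - 1| ^ (q - 2) *
        ‖gradient (fun y => curvQ p b u y t - 1) x‖ ^ 2 * u x t ^ 2 =
      ∫ x in Ω, |-p * (ut x t / u x t)| ^ (q - 2) *
        ‖gradient (fun y => -p * (ut y t / u y t)) x‖ ^ 2 * u x t ^ 2 := by
    refine setIntegral_congr_fun hΩ.measurableSet fun x hx => ?_
    have h1 : (fun y => curvQ p b u y t - 1) =ᶠ[𝓝 x] fun y => -p * (ut y t / u y t) := by
      filter_upwards [hΩ.mem_nhds hx] with y hy using (hpt y hy t ht).2.2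
    simp only [(hpt x hx t ht).2.2, gradient, h1.fderiv_eq]
  have hid := fun x (hx : x ∈ Ω) => moment_integrand_identity (q := q) hp
    (hpos x hx t (hI t ht)) hq rfl (hpt x hx t ht).1 (hpt x hx t ht).2.1
  have hreact : IntegrableOn (fun x =>
      ((p - 1) / p * (q - (p + 1) / (p - 1)) *
          (|-p * (ut x t / u x t)| ^ q * (-p * (ut x t / u x t))) +
        (q - q / p) * |-p * (ut x t / u x t)| ^ q) * u x t ^ (p + 1)) Ω :=
    (hint.sub (hflux.const_mul (q / p))).congr
      (ae_restrict_of_forall_mem hΩ.measurableSet fun x hx => by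
        simp only [Pi.sub_apply, hid x hx, add_sub_cancel_left])
  have hreact_eq : ∫ x in Ω, ((p - 1) / p * (q - (p + 1) / (p - 1)) *
          (|curvQ p b u x t - 1| ^ q * (curvQ p b u x t - 1)) +
        (q - q / p) * |curvQ p b u x t - 1| ^ q) * u x t ^ (p + 1) =
      ∫ x in Ω, ((p - 1) / p * (q - (p + 1) / (p - 1)) *
          (|-p * (ut x t / u x t)| ^ q * (-p * (ut x t / u x t))) +
        (q - q / p) * |-p * (ut x t / u x t)| ^ q) * u x t ^ (p + 1) :=
    setIntegral_congr_fun hΩ.measurableSet fun x hx => by simp only [(hpt x hx t ht).2.2]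
  rw [setIntegral_congr_fun hΩ.measurableSet hid, integral_add (hflux.const_mul _) hreact,
    integral_const_mul, hgrad, hreact_eq]
  linear_combination (q / p) * hparts
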